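/- Let κ, μ, m_d, r̂ > 0, m_t > 1 and r > 0. Set K = μ(1+κ). Then ∫₀^∞ (2μ^μ(1+κ)^μ r^{2μ−1} m_d^{m_d} / (Γ(μ)(m_d+μκ)^{m_d} α^{2μ} r̂^{2μ})) e^{−μ(1+κ)r²/(α²r̂²)} ₁F₁(m_d; μ; μ²κ(1+κ)r²/(α²r̂²(m_d+μκ))) · (2(m_t−1)^{m_t} α^{−2m_t−1} e^{−(m_t−1)/α²}/Γ(m_t)) dα = (2(m_t−1)^{m_t} m_d^{m_d} K^μ r^{2μ−1} r̂^{2m_t} / ((m_d+μκ)^{m_d} B(m_t,μ)(K r² + (m_t−1)r̂²)^{m_t+μ})) · ₂F₁(m_d, m_t+μ; μ; K μ κ r² / ((m_d+μκ)(K r² + (m_t−1)r̂²))), where the argument of ₂F₁ lies in (0,1). -/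

import Mathlib

open MeasureTheory Set

/-- Pochhammer (rising factorial) symbol `(a)_n = Γ(a+n)/Γ(a)`. -/
noncomputable def poch (a : ℝ) (n : ℕ) : ℝ := Real.Gamma (a + n) / Real.Gamma a

/-- Beta function `B(x,y) = Γ(x)Γ(y)/Γ(x+y)`. -/
noncomputable def betaFn (x y : ℝ) : ℝ := Real.Gamma x * Real.Gamma y / Real.Gamma (x + y)

/-- Modified Bessel function of the first kind of real order ν. -/
noncomputable def besselI (ν x : ℝ) : ℝ :=
  ∑' k : ℕ, (x / 2) ^ (ν + 2 * (k : ℝ)) / ((k.factorial : ℝ) * Real.Gamma (ν + (k : ℝ) + 1))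

/-- Modified Bessel function of the second kind of real order ν. -/
noncomputable def besselK (ν x : ℝ) : ℝ :=
  ∫ t in Ioi (0 : ℝ), Real.exp (-x * Real.cosh t) * Real.cosh (ν * t)

/-- Confluent hypergeometric function ₁F₁(a;b;z). -/
noncomputable def hyp1F1 (a b z : ℝ) : ℝ :=
  ∑' n : ℕ, poch a n * z ^ n / (poch b n * (n.factorial : ℝ))

/-- Gauss hypergeometric function ₂F₁(a,b;c;z). -/
noncomputable def hyp2F1 (a b c z : ℝ) : ℝ :=
  ∑' n : ℕ, poch a n * poch b n * z ^ n / (poch c n * (n.factorial : ℝ))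

/-- Tricomi confluent hypergeometric function U(a,b,z). -/
noncomputable def tricomiU (a b z : ℝ) : ℝ :=
  (1 / Real.Gamma a) *
    ∫ t in Ioi (0 : ℝ), Real.exp (-z * t) * t ^ (a - 1) * (1 + t) ^ (b - a - 1)

/-- Regularized generalized hypergeometric function ₃F̃₁(a₁,a₂,a₃;b;z). -/
noncomputable def hyp3F1reg (a₁ a₂ a₃ b z : ℝ) : ℝ :=
  ∑' n : ℕ, poch a₁ n * poch a₂ n * poch a₃ n * z ^ n /
    (Real.Gamma (b + n) * (n.factorial : ℝ))

/-- Regularized generalized hypergeometric function ₂F̃₂(a,b;c,d;z). -/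
noncomputable def hyp2F2reg (a b c d z : ℝ) : ℝ :=
  ∑' n : ℕ, poch a n * poch b n * z ^ n /
    (Real.Gamma (c + n) * Real.Gamma (d + n) * (n.factorial : ℝ))

theorem poch_pos {a : ℝ} (ha : 0 < a) (n : ℕ) : 0 < poch a n :=
  div_pos (Real.Gamma_pos_of_pos (by positivity)) (Real.Gamma_pos_of_pos ha)

theorem poch_succ {a : ℝ} (ha : 0 < a) (n : ℕ) : poch a (n + 1) = (a + n) * poch a n := by
  have h : a + ((n + 1 : ℕ) : ℝ) = (a + n) + 1 := by push_cast; ring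
  rw [poch, poch, h, Real.Gamma_add_one (by positivity)]
  ring

theorem tendsto_add_natCast_div_add_natCast (a b : ℝ) :
    Filter.Tendsto (fun n : ℕ => (a + n) / (b + n)) Filter.atTop (nhds 1) := by
  have := tendsto_add_mul_div_add_mul_atTop_nhds a b (1 : ℝ) (one_ne_zero (α := ℝ))
  simpa using this

/-- The Gauss hypergeometric series with positive parameters converges on `(0, 1)`. -/
theorem summable_hyp2F1 {a b c z : ℝ} (ha : 0 < a) (hb : 0 < b) (hc : 0 < c)
    (hz : 0 < z) (hz1 : z < 1) :
    Summable fun n : ℕ => poch a n * poch b n * z ^ n / (poch c n * (n.factorial : ℝ)) := by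
  have hpos : ∀ n : ℕ, 0 < poch a n * poch b n * z ^ n / (poch c n * (n.factorial : ℝ)) := by
    intro n
    have := poch_pos ha n
    have := poch_pos hb n
    have := poch_pos hc n
    positivity
  refine summable_of_ratio_test_tendsto_lt_one hz1 (.of_forall fun n => (hpos n).ne') ?_
  have hlim := ((tendsto_add_natCast_div_add_natCast a c).mul
    (tendsto_add_natCast_div_add_natCast b 1)).mul_const z
  rw [one_mul, one_mul] at hlim
  refine hlim.congr fun n => ?_
  rw [Real.norm_of_nonneg (hpos _).le, Real.norm_of_nonneg (hpos _).le, poch_succ ha,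
    poch_succ hb, poch_succ hc, Nat.factorial_succ, pow_succ]
  have := poch_pos ha n
  have := poch_pos hb n
  have := poch_pos hc n
  push_cast
  field_simp
  ring

theorem abs_mul_rpow_smul_eq {s A x : ℝ} (hx : 0 < x) :
    (|(-2 : ℝ)| * x ^ ((-2 : ℝ) - 1)) •
        ((x ^ (-2 : ℝ)) ^ (s - 1) * Real.exp (-(A * x ^ (-2 : ℝ)))) =
      2 * (x ^ (-2 * s - 1) * Real.exp (-A / x ^ 2)) := by
  have h1 : x ^ (-2 * s - 1) = x ^ ((-2 : ℝ) - 1) * (x ^ (-2 : ℝ)) ^ (s - 1) := by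
    rw [← Real.rpow_mul hx.le, ← Real.rpow_add hx]
    congr 1
    ring
  have h2 : x ^ (-2 : ℝ) = (x ^ 2)⁻¹ := by
    rw [Real.rpow_neg hx.le, Real.rpow_two]
  rw [h1, abs_of_neg (by norm_num : (-2 : ℝ) < 0), smul_eq_mul,
    show -(A * x ^ (-2 : ℝ)) = -A / x ^ 2 by rw [h2]; ring]
  ring

theorem integrableOn_rpow_mul_exp_neg_div_sq {s A : ℝ} (hs : 0 < s) (hA : 0 < A) :
    IntegrableOn (fun x : ℝ => x ^ (-2 * s - 1) * Real.exp (-A / x ^ 2)) (Ioi 0) := by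
  have h : IntegrableOn (fun y : ℝ => y ^ (s - 1) * Real.exp (-(A * y))) (Ioi 0) := by
    simpa using integrableOn_rpow_mul_exp_neg_mul_rpow (s := s - 1) (p := 1) (b := A)
      (by linarith) one_pos hA
  have h2 := (integrableOn_Ioi_comp_rpow_iff _ (show (-2 : ℝ) ≠ 0 by norm_num)).2 h
  have h3 := (h2.congr_fun (fun x hx => abs_mul_rpow_smul_eq hx) measurableSet_Ioi).const_mul
    (1 / 2)
  refine IntegrableOn.congr_fun h3 (fun x _ => ?_) measurableSet_Ioi
  ring

theorem integral_rpow_mul_exp_neg_div_sq {s A : ℝ} (hs : 0 < s) (hA : 0 < A) :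
    ∫ x in Ioi (0 : ℝ), x ^ (-2 * s - 1) * Real.exp (-A / x ^ 2) =
      Real.Gamma s / (2 * A ^ s) := by
  have h := integral_comp_rpow_Ioi (fun y : ℝ => y ^ (s - 1) * Real.exp (-(A * y)))
    (show (-2 : ℝ) ≠ 0 by norm_num)
  rw [setIntegral_congr_fun measurableSet_Ioi (fun x hx => abs_mul_rpow_smul_eq hx),
    integral_const_mul, Real.integral_rpow_mul_exp_neg_mul_Ioi hs hA, one_div,
    Real.inv_rpow hA.le] at h
  have := Real.rpow_pos_of_pos hA s
  field_simp at h ⊢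
  linarith

/-- Termwise integration of `₁F₁` against an inverse Nakagami kernel produces `₂F₁`. -/
theorem integral_rpow_mul_exp_mul_hyp1F1 {a b c s A : ℝ} (ha : 0 < a) (hb : 0 < b)
    (hs : 0 < s) (hc : 0 < c) (hcA : c < A) :
    ∫ x in Ioi (0 : ℝ), x ^ (-2 * s - 1) * Real.exp (-A / x ^ 2) * hyp1F1 a b (c / x ^ 2) =
      Real.Gamma s / (2 * A ^ s) * hyp2F1 a s b (c / A) := by
  have hA : 0 < A := hc.trans hcA
  have hAs := Real.rpow_pos_of_pos hA s
  have hΓ := Real.Gamma_pos_of_pos hs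
  let F : ℕ → ℝ → ℝ := fun n x => poch a n * c ^ n / (poch b n * (n.factorial : ℝ)) *
    (x ^ (-2 * (s + n) - 1) * Real.exp (-A / x ^ 2))
  have hF : ∀ n, ∀ x ∈ Ioi (0 : ℝ), F n x = x ^ (-2 * s - 1) * Real.exp (-A / x ^ 2) *
      (poch a n * (c / x ^ 2) ^ n / (poch b n * (n.factorial : ℝ))) := by
    intro n x hx
    have hx : 0 < x := hx
    have h : x ^ (-2 * (s + n) - 1) = x ^ (-2 * s - 1) / (x ^ 2) ^ n := by
      rw [← pow_mul, ← Real.rpow_natCast, ← Real.rpow_sub hx]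
      congr 1
      push_cast
      ring
    simp only [F]
    rw [h, div_pow]
    ring
  have hFint : ∀ n, Integrable (F n) (volume.restrict (Ioi 0)) := fun n =>
    (integrableOn_rpow_mul_exp_neg_div_sq (by positivity) hA).const_mul _
  have hFval : ∀ n, ∫ x in Ioi (0 : ℝ), F n x = Real.Gamma s / (2 * A ^ s) *
      (poch a n * poch s n * (c / A) ^ n / (poch b n * (n.factorial : ℝ))) := by
    intro n
    simp only [F]
    rw [integral_const_mul, integral_rpow_mul_exp_neg_div_sq (by positivity) hA,
      Real.rpow_add hA, Real.rpow_natCast, show poch s n = Real.Gamma (s + n) / Real.Gamma s from rfl,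
      div_pow]
    have := poch_pos hb n
    field_simp
  have hnorm : ∀ n, ∫ x in Ioi (0 : ℝ), ‖F n x‖ = ∫ x in Ioi (0 : ℝ), F n x := by
    intro n
    refine setIntegral_congr_fun measurableSet_Ioi fun x hx => ?_
    have hx : 0 < x := hx
    have := poch_pos ha n
    have := poch_pos hb n
    exact Real.norm_of_nonneg (by simp only [F]; positivity)
  have hsum : Summable fun n => ∫ x in Ioi (0 : ℝ), ‖F n x‖ := by
    simp only [hnorm, hFval]
    exact (summable_hyp2F1 ha hs hb (div_pos hc hA) ((div_lt_one hA).2 hcA)).mul_left _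
  have key := integral_tsum_of_summable_integral_norm hFint hsum
  rw [hyp2F1, ← tsum_mul_left]
  simp only [hFval] at key
  rw [key]
  refine setIntegral_congr_fun measurableSet_Ioi fun x hx => ?_
  simp only [hyp1F1]
  rw [← tsum_mul_left]
  exact tsum_congr fun n => (hF n x hx).symm

/-- Theorem 5: PDF of the double shadowed κ-μ Type I model, example 1. -/
theorem double_shadowed_typeI_example1_pdf
    (κ μ md mt rhat r K : ℝ)
    (hκ : 0 < κ) (hμ : 0 < μ) (hmd : 0 < md) (hrhat : 0 < rhat) (hmt : 1 < mt)
    (hr : 0 < r) (hK : K = μ * (1 + κ)) :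
    (0 < K * μ * κ * r ^ 2 / ((md + μ * κ) * (K * r ^ 2 + (mt - 1) * rhat ^ 2)) ∧
      K * μ * κ * r ^ 2 / ((md + μ * κ) * (K * r ^ 2 + (mt - 1) * rhat ^ 2)) < 1) ∧
    (∫ α in Ioi (0 : ℝ),
      (2 * μ ^ μ * (1 + κ) ^ μ * r ^ (2 * μ - 1) * md ^ md /
          (Real.Gamma μ * (md + μ * κ) ^ md * α ^ (2 * μ) * rhat ^ (2 * μ))) *
        Real.exp (-μ * (1 + κ) * r ^ 2 / (α ^ 2 * rhat ^ 2)) *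
        hyp1F1 md μ (μ ^ 2 * κ * (1 + κ) * r ^ 2 / (α ^ 2 * rhat ^ 2 * (md + μ * κ))) *
        (2 * (mt - 1) ^ mt * α ^ (-2 * mt - 1) *
          Real.exp (-(mt - 1) / α ^ 2) / Real.Gamma mt)) =
    (2 * (mt - 1) ^ mt * md ^ md * K ^ μ * r ^ (2 * μ - 1) * rhat ^ (2 * mt) /
        ((md + μ * κ) ^ md * betaFn mt μ *
          (K * r ^ 2 + (mt - 1) * rhat ^ 2) ^ (mt + μ))) *
      hyp2F1 md (mt + μ) μ
        (K * μ * κ * r ^ 2 / ((md + μ * κ) * (K * r ^ 2 + (mt - 1) * rhat ^ 2))) := by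
  subst hK
  have hm : 0 < mt - 1 := by linarith
  have hS : 0 < μ * (1 + κ) * r ^ 2 + (mt - 1) * rhat ^ 2 := by positivity
  have hlt : μ * (1 + κ) * μ * κ * r ^ 2 /
      ((md + μ * κ) * (μ * (1 + κ) * r ^ 2 + (mt - 1) * rhat ^ 2)) < 1 := by
    rw [div_lt_one (by positivity)]
    have h1 : 0 < md * (μ * (1 + κ) * r ^ 2 + (mt - 1) * rhat ^ 2) := by positivity
    have h2 : 0 < μ * κ * ((mt - 1) * rhat ^ 2) := by positivity
    linarith
  refine ⟨⟨by positivity, hlt⟩, ?_⟩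
  set S := μ * (1 + κ) * r ^ 2 + (mt - 1) * rhat ^ 2 with hSdef
  have hA : 0 < S / rhat ^ 2 := by positivity
  have hc : 0 < μ ^ 2 * κ * (1 + κ) * r ^ 2 / (rhat ^ 2 * (md + μ * κ)) := by positivity
  have hcA : μ ^ 2 * κ * (1 + κ) * r ^ 2 / (rhat ^ 2 * (md + μ * κ)) / (S / rhat ^ 2) =
      μ * (1 + κ) * μ * κ * r ^ 2 / ((md + μ * κ) * S) := by
    field_simp
  have main := integral_rpow_mul_exp_mul_hyp1F1 hmd hμ (show 0 < mt + μ by linarith) hc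
    ((div_lt_one hA).1 (hcA.trans_lt hlt))
  rw [hcA] at main
  have hΓμ := Real.Gamma_pos_of_pos hμ
  have hΓm := Real.Gamma_pos_of_pos (show 0 < mt by linarith)
  have hΓs := Real.Gamma_pos_of_pos (show 0 < mt + μ by linarith)
  have hS' : (S / rhat ^ 2) ^ (mt + μ) = S ^ (mt + μ) / (rhat ^ (2 * mt) * rhat ^ (2 * μ)) := by
    rw [Real.div_rpow hS.le (by positivity), ← Real.rpow_add hrhat, ← mul_add,
      Real.rpow_mul hrhat.le, Real.rpow_two]
  have hcongr : ∀ α ∈ Ioi (0 : ℝ),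
      (2 * μ ^ μ * (1 + κ) ^ μ * r ^ (2 * μ - 1) * md ^ md /
          (Real.Gamma μ * (md + μ * κ) ^ md * α ^ (2 * μ) * rhat ^ (2 * μ))) *
        Real.exp (-μ * (1 + κ) * r ^ 2 / (α ^ 2 * rhat ^ 2)) *
        hyp1F1 md μ (μ ^ 2 * κ * (1 + κ) * r ^ 2 / (α ^ 2 * rhat ^ 2 * (md + μ * κ))) *
        (2 * (mt - 1) ^ mt * α ^ (-2 * mt - 1) *
          Real.exp (-(mt - 1) / α ^ 2) / Real.Gamma mt) =
      (4 * (μ * (1 + κ)) ^ μ * r ^ (2 * μ - 1) * md ^ md * (mt - 1) ^ mt /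
          (Real.Gamma μ * (md + μ * κ) ^ md * rhat ^ (2 * μ) * Real.Gamma mt)) *
        (α ^ (-2 * (mt + μ) - 1) * Real.exp (-(S / rhat ^ 2) / α ^ 2) *
          hyp1F1 md μ (μ ^ 2 * κ * (1 + κ) * r ^ 2 / (rhat ^ 2 * (md + μ * κ)) / α ^ 2)) := by
    intro α hα
    have hα : 0 < α := hα
    have hexp : Real.exp (-(S / rhat ^ 2) / α ^ 2) =
        Real.exp (-μ * (1 + κ) * r ^ 2 / (α ^ 2 * rhat ^ 2)) *
          Real.exp (-(mt - 1) / α ^ 2) := by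
      rw [← Real.exp_add]
      congr 1
      rw [hSdef]
      field_simp
      ring
    have hpow : α ^ (-2 * (mt + μ) - 1) = α ^ (-2 * mt - 1) / α ^ (2 * μ) := by
      rw [← Real.rpow_sub hα]
      congr 1
      ring
    have harg : μ ^ 2 * κ * (1 + κ) * r ^ 2 / (rhat ^ 2 * (md + μ * κ)) / α ^ 2 =
        μ ^ 2 * κ * (1 + κ) * r ^ 2 / (α ^ 2 * rhat ^ 2 * (md + μ * κ)) := by
      rw [div_div]
      congr 1
      ring
    rw [hexp, hpow, harg, Real.mul_rpow hμ.le (by positivity)]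
    ring
  rw [setIntegral_congr_fun measurableSet_Ioi hcongr, integral_const_mul, main, hS', betaFn]
  have h1 := Real.rpow_pos_of_pos hrhat (2 * μ)
  have h2 := Real.rpow_pos_of_pos hrhat (2 * mt)
  have h3 := Real.rpow_pos_of_pos hS (mt + μ)
  have h4 := Real.rpow_pos_of_pos (show 0 < md + μ * κ by positivity) md
  generalize hyp2F1 _ _ _ _ = H
  generalize rhat ^ (2 * μ) = x1 at *
  generalize rhat ^ (2 * mt) = x2 at *
  generalize S ^ (mt + μ) = x3 at *
  generalize (md + μ * κ) ^ md = x4 at *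
  field_simp
  ring
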